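/- arXiv:math/0607006 — 2 statements merged into one kernel-verified Lean document; each statement's English description precedes it below -/
import Mathlib

section
/- Let n = n₁+n₂+n₃ = p+q with min(p,q) ≥ 3 and min(n₁,n₂,n₃) ≥ 2. Set G = U(n), L = U(n₁)×U(n₂)×U(n₃) (block-diagonal), G' = O(n), H = U(p)×U(q) (block-diagonal). Then L·G'·H ≠ G. -/
open Matrix
open scoped Pointwise

/-- The block index of position `i` for the partition `n = ns 0 + ⋯ + ns (k-1)`. -/
def blkIdx (ns : ℕ → ℕ) (k i : ℕ) : ℕ :=
  ((Finset.range k).filter (fun j => (∑ t ∈ Finset.range (j+1), ns t) ≤ i)).card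

/-- `U(n₁) × ⋯ × U(n_k)` embedded block-diagonally in `U(n)`. -/
def blockUnitary (n k : ℕ) (ns : ℕ → ℕ) : Set (Matrix (Fin n) (Fin n) ℂ) :=
  {u | u ∈ Matrix.unitaryGroup (Fin n) ℂ ∧
    ∀ i j : Fin n, blkIdx ns k i.1 ≠ blkIdx ns k j.1 → u i j = 0}

/-- `O(n)` viewed inside `U(n)`: unitary matrices with real entries. -/
def realOrthogonal (n : ℕ) : Set (Matrix (Fin n) (Fin n) ℂ) :=
  {g | g ∈ Matrix.unitaryGroup (Fin n) ℂ ∧ ∀ i j, (g i j).im = 0}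

/-- A noncommutative word whose trace separates the double coset space
`L \ G / H` from its real points. -/
def cyclicWord {R : Type*} [Mul R] (D E X : R) : R :=
  D * X * (D * X) * (E * X) * (D * X) * (E * X) * (E * X)

theorem map_cyclicWord {R S F : Type*} [Mul R] [Mul S] [FunLike F R S] [MulHomClass F R S]
    (f : F) (D E X : R) : f (cyclicWord D E X) = cyclicWord (f D) (f E) (f X) := by
  simp [cyclicWord]

theorem cyclicWord_conj {R : Type*} [Monoid R] {l m D E : R} (hml : m * l = 1)
    (hD : Commute D l) (hE : Commute E l) (X : R) :
    cyclicWord D E (l * X * m) = l * cyclicWord D E X * m := by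
  have key (F Y : R) (hF : Commute F l) : F * (l * Y * m) = l * (F * Y) * m := by
    rw [← mul_assoc, ← mul_assoc, hF.eq, mul_assoc l F Y]
  have mul_conj (Y Z : R) : l * Y * m * (l * Z * m) = l * (Y * Z) * m := by
    calc l * Y * m * (l * Z * m) = l * Y * (m * l) * Z * m := by simp only [mul_assoc]
      _ = l * (Y * Z) * m := by rw [hml]; simp only [mul_assoc, one_mul]
  simp only [cyclicWord, key D _ hD, key E _ hE, mul_conj]

/-- The subring of complex matrices with real entries. -/
def realMatrices (ι : Type*) [Fintype ι] [DecidableEq ι] : Subring (Matrix ι ι ℂ) :=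
  Complex.ofRealHom.mapMatrix.range

theorem mem_realMatrices {ι : Type*} [Fintype ι] [DecidableEq ι] {M : Matrix ι ι ℂ} :
    M ∈ realMatrices ι ↔ ∀ i j, (M i j).im = 0 := by
  constructor
  · rintro ⟨N, rfl⟩ i j
    simp
  · intro h
    refine ⟨M.map Complex.re, ?_⟩
    ext i j
    apply Complex.ext <;> simp [h]

theorem im_trace_of_mem_realMatrices {ι : Type*} [Fintype ι] [DecidableEq ι] {M : Matrix ι ι ℂ}
    (hM : M ∈ realMatrices ι) : M.trace.im = 0 := by
  simp [Matrix.trace, mem_realMatrices.1 hM]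

theorem cyclicWord_mem {R S : Type*} [Mul R] [SetLike S R] [MulMemClass S R] (s : S) {D E X : R}
    (hD : D ∈ s) (hE : E ∈ s) (hX : X ∈ s) : cyclicWord D E X ∈ s := by
  unfold cyclicWord
  have h1 := mul_mem hD hX
  have h2 := mul_mem hE hX
  exact mul_mem (mul_mem (mul_mem (mul_mem (mul_mem h1 h1) h2) h1) h2) h2

/-- The diagonal projection onto the coordinates satisfying `P`. -/
def diagProj (R : Type*) [Zero R] [One R] {ι : Type*} [DecidableEq ι] (P : ι → Prop)
    [DecidablePred P] : Matrix ι ι R :=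
  diagonal fun i => if P i then 1 else 0

theorem diagProj_congr {R : Type*} [Zero R] [One R] {ι : Type*} [DecidableEq ι] {P Q : ι → Prop}
    [DecidablePred P] [DecidablePred Q] (h : ∀ i, P i ↔ Q i) : diagProj R P = diagProj R Q := by
  simp only [diagProj, h]

theorem diagProj_mem_realMatrices {ι : Type*} [Fintype ι] [DecidableEq ι] (P : ι → Prop)
    [DecidablePred P] : diagProj ℂ P ∈ realMatrices ι := by
  rw [mem_realMatrices]
  intro i j
  by_cases h : i = j
  · subst h
    by_cases hP : P i <;> simp [diagProj, hP]
  · simp [diagProj, h]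

theorem map_diagProj {R S : Type*} [NonAssocSemiring R] [NonAssocSemiring S] (f : R →+* S)
    {ι : Type*} [Fintype ι] [DecidableEq ι] (P : ι → Prop) [DecidablePred P] :
    f.mapMatrix (diagProj R P) = diagProj S P := by
  simp only [diagProj, RingHom.mapMatrix_apply, diagonal_map (map_zero f)]
  congr 1
  ext i
  simp [apply_ite f]

theorem diagProj_submatrix {R : Type*} [Zero R] [One R] {ι κ : Type*} [DecidableEq ι]
    [DecidableEq κ] (P : ι → Prop) [DecidablePred P] (e : κ ≃ ι) :
    (diagProj R P).submatrix e e = diagProj R fun k => P (e k) := by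
  simp only [diagProj, submatrix_diagonal_equiv]
  rfl

theorem diagProj_sum {R : Type*} [Zero R] [One R] {ι κ : Type*} [DecidableEq ι]
    [DecidableEq κ] (P : ι ⊕ κ → Prop) [DecidablePred P] :
    diagProj R P = fromBlocks (diagProj R fun i => P (.inl i)) 0 0
      (diagProj R fun k => P (.inr k)) := by
  simp only [diagProj, fromBlocks_diagonal]
  congr 1
  ext (i | k) <;> rfl

theorem commute_diagProj_of_mem_blockUnitary {n k : ℕ} {ns : ℕ → ℕ}
    {u : Matrix (Fin n) (Fin n) ℂ} (hu : u ∈ blockUnitary n k ns) (a : ℕ) :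
    Commute (diagProj ℂ fun i : Fin n => blkIdx ns k i = a) u := by
  ext i j
  by_cases h : blkIdx ns k i = blkIdx ns k j
  · simp [diagProj, diagonal_mul, mul_diagonal, h]
  · simp [diagProj, diagonal_mul, mul_diagonal, hu.2 i j h]

/-- On `L * O(n) * H` the invariant is real. -/
theorem im_trace_cyclicWord_of_mem {n k m : ℕ} {ns ms : ℕ → ℕ} {g : Matrix (Fin n) (Fin n) ℂ}
    (hg : g ∈ blockUnitary n k ns * realOrthogonal n * blockUnitary n m ms) (a b c : ℕ) :
    (cyclicWord (diagProj ℂ fun i : Fin n => blkIdx ns k i = a)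
      (diagProj ℂ fun i : Fin n => blkIdx ns k i = b)
      (g * (diagProj ℂ fun i : Fin n => blkIdx ms m i = c) * gᴴ)).trace.im = 0 := by
  obtain ⟨_, ⟨l, hl, o, ho, rfl⟩, h, hh, rfl⟩ := hg
  have hl1 : lᴴ * l = 1 := mem_unitaryGroup_iff'.1 hl.1
  have hh1 : h * hᴴ = 1 := mem_unitaryGroup_iff.1 hh.1
  set J := diagProj ℂ fun i : Fin n => blkIdx ms m i = c with hJ
  have hJc : Commute J h := commute_diagProj_of_mem_blockUnitary hh c
  have hX : l * o * h * J * (l * o * h)ᴴ = l * (o * J * oᴴ) * lᴴ := by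
    calc l * o * h * J * (l * o * h)ᴴ = l * o * (h * J) * hᴴ * oᴴ * lᴴ := by
          simp only [conjTranspose_mul, Matrix.mul_assoc]
      _ = l * o * J * (h * hᴴ) * oᴴ * lᴴ := by
          rw [← hJc.eq]; simp only [Matrix.mul_assoc]
      _ = l * (o * J * oᴴ) * lᴴ := by
          rw [hh1]; simp only [Matrix.mul_assoc, Matrix.one_mul]
  have ho1 : o ∈ realMatrices (Fin n) := mem_realMatrices.2 ho.2
  have ho2 : oᴴ ∈ realMatrices (Fin n) := mem_realMatrices.2 fun i j => by
    simp [conjTranspose_apply, ho.2]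
  simp only [hX]
  rw [cyclicWord_conj hl1 (commute_diagProj_of_mem_blockUnitary hl a)
    (commute_diagProj_of_mem_blockUnitary hl b), trace_mul_comm, ← Matrix.mul_assoc, hl1,
    Matrix.one_mul]
  exact im_trace_of_mem_realMatrices (cyclicWord_mem _ (diagProj_mem_realMatrices _)
    (diagProj_mem_realMatrices _)
    (mul_mem (mul_mem ho1 (diagProj_mem_realMatrices _)) ho2))

/-- A Gaussian integer matrix with `V * Vᴴ = 8`. -/
def gaussV : Matrix (Fin 6) (Fin 6) GaussianInt :=
  !![-1, -1, 0, 2, 1, 1;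
    1, ⟨0, -1⟩, ⟨1, 1⟩, ⟨1, -1⟩, -1, ⟨0, 1⟩;
    -1, 1, 2, 0, 1, -1;
    -2, 0, 0, 0, -2, 0;
    0, ⟨0, 2⟩, 0, 0, 0, ⟨0, 2⟩;
    1, ⟨0, 1⟩, ⟨1, -1⟩, ⟨1, 1⟩, -1, ⟨0, -1⟩]

theorem gaussV_mul_conjTranspose : gaussV * gaussVᴴ = 8 := by
  decide +kernel

theorem im_trace_cyclicWord_gaussV :
    (cyclicWord (diagProj GaussianInt fun i : Fin 6 => i.1 / 2 = 0)
      (diagProj GaussianInt fun i : Fin 6 => i.1 / 2 = 1)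
      (gaussV * (diagProj GaussianInt fun i : Fin 6 => i.1 / 3 = 0) * gaussVᴴ)).trace.im = 32 := by
  decide +kernel

/-- The unitary matrix obtained by normalizing `gaussV`. -/
noncomputable def unitaryV : Matrix (Fin 6) (Fin 6) ℂ :=
  ((√8 : ℝ)⁻¹ : ℂ) • GaussianInt.toComplex.mapMatrix gaussV

theorem conjTranspose_mapMatrix_toComplex {ι : Type*} [Fintype ι] [DecidableEq ι]
    (M : Matrix ι ι GaussianInt) :
    (GaussianInt.toComplex.mapMatrix M)ᴴ = GaussianInt.toComplex.mapMatrix Mᴴ := by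
  ext i j
  simp [conjTranspose_apply, GaussianInt.toComplex_star]

theorem unitaryV_mul_mul_conjTranspose (M : Matrix (Fin 6) (Fin 6) GaussianInt) :
    unitaryV * GaussianInt.toComplex.mapMatrix M * unitaryVᴴ
      = (8⁻¹ : ℂ) • GaussianInt.toComplex.mapMatrix (gaussV * M * gaussVᴴ) := by
  have h : ((√8 : ℝ)⁻¹ : ℂ) * ((√8 : ℝ)⁻¹ : ℂ) = 8⁻¹ := by
    rw [← mul_inv, ← Complex.ofReal_mul, Real.mul_self_sqrt (by norm_num)]
    norm_num
  rw [unitaryV, conjTranspose_smul, conjTranspose_mapMatrix_toComplex]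
  simp [smul_smul, h]

theorem unitaryV_mul_conjTranspose : unitaryV * unitaryVᴴ = 1 := by
  have h := unitaryV_mul_mul_conjTranspose 1
  rw [map_one, Matrix.mul_one, Matrix.mul_one, gaussV_mul_conjTranspose, map_ofNat] at h
  rw [h]
  ext i j
  by_cases hij : i = j
  · subst hij
    simp [ofNat_apply]
  · simp [hij, ofNat_apply]

theorem im_trace_cyclicWord_unitaryV :
    (cyclicWord (diagProj ℂ fun i : Fin 6 => i.1 / 2 = 0)
      (diagProj ℂ fun i : Fin 6 => i.1 / 2 = 1)
      (unitaryV * (diagProj ℂ fun i : Fin 6 => i.1 / 3 = 0) * unitaryVᴴ)).trace.im ≠ 0 := by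
  have hsmul (D E X : Matrix (Fin 6) (Fin 6) ℂ) :
      cyclicWord D E ((8⁻¹ : ℂ) • X) = ((8⁻¹ : ℝ) ^ 6 : ℝ) • cyclicWord D E X := by
    have h8 : ((8⁻¹ : ℂ) • X) = (8⁻¹ : ℝ) • X := by
      ext i j
      simp
    simp only [cyclicWord, h8, Matrix.mul_smul, Matrix.smul_mul, smul_smul]
    congr 1
    ring
  have htrace (M : Matrix (Fin 6) (Fin 6) GaussianInt) :
      (GaussianInt.toComplex.mapMatrix M).trace = GaussianInt.toComplex M.trace := by
    simp [Matrix.trace]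
  rw [← map_diagProj GaussianInt.toComplex fun i : Fin 6 => i.1 / 3 = 0,
    unitaryV_mul_mul_conjTranspose, hsmul,
    ← map_diagProj GaussianInt.toComplex fun i : Fin 6 => i.1 / 2 = 0,
    ← map_diagProj GaussianInt.toComplex fun i : Fin 6 => i.1 / 2 = 1,
    ← map_cyclicWord, trace_smul, htrace, Complex.smul_im, ← GaussianInt.intCast_im,
    im_trace_cyclicWord_gaussV]
  norm_num

theorem exists_equiv_extending {m r n : ℕ} (h : m + r = n) {e : Fin m → Fin n}
    (he : Function.Injective e) : ∃ E : Fin m ⊕ Fin r ≃ Fin n, ∀ i, E (.inl i) = e i := by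
  let E₀ : Fin m ⊕ Fin r ≃ Fin n := finSumFinEquiv.trans (finCongr h)
  obtain ⟨σ, hσ⟩ := Equiv.Perm.exists_extending_pair (fun i => E₀ (.inl i)) e
    (E₀.injective.comp Sum.inl_injective) he
  exact ⟨E₀.trans σ, hσ⟩

theorem trace_fromBlocks_eq_add {ι κ R : Type*} [Fintype ι] [Fintype κ] [AddCommMonoid R]
    (M : Matrix ι ι R) (N : Matrix ι κ R) (P : Matrix κ ι R) (Q : Matrix κ κ R) :
    (fromBlocks M N P Q).trace = M.trace + Q.trace := by
  simp [Matrix.trace]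

theorem exists_unitary_im_trace_ne_zero {n : ℕ} (A B C : Fin n → Prop)
    [DecidablePred A] [DecidablePred B] [DecidablePred C] {e f : Fin 6 → Fin n}
    (he : Function.Injective e) (hf : Function.Injective f)
    (hA : ∀ i, A (e i) ↔ i.1 / 2 = 0) (hB : ∀ i, B (e i) ↔ i.1 / 2 = 1)
    (hC : ∀ i, C (f i) ↔ i.1 / 3 = 0) :
    ∃ g ∈ Matrix.unitaryGroup (Fin n) ℂ,
      (cyclicWord (diagProj ℂ A) (diagProj ℂ B) (g * diagProj ℂ C * gᴴ)).trace.im ≠ 0 := by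
  have hn : 6 + (n - 6) = n := by
    have := Fintype.card_le_of_injective e he
    simp only [Fintype.card_fin] at this
    omega
  obtain ⟨E, hE⟩ := exists_equiv_extending hn he
  obtain ⟨F, hF⟩ := exists_equiv_extending hn hf
  let U : Matrix (Fin 6 ⊕ Fin (n - 6)) (Fin 6 ⊕ Fin (n - 6)) ℂ := fromBlocks unitaryV 0 0 1
  have hU : U * Uᴴ = 1 := by
    simp [U, fromBlocks_conjTranspose, fromBlocks_multiply, unitaryV_mul_conjTranspose]
  refine ⟨U.submatrix E.symm F.symm, ?_, ?_⟩
  · rw [mem_unitaryGroup_iff, star_eq_conjTranspose, conjTranspose_submatrix,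
      submatrix_mul_equiv, hU, submatrix_one_equiv]
  · have hsub (P : Fin n → Prop) [DecidablePred P] (K : Fin 6 ⊕ Fin (n - 6) ≃ Fin n) :
        diagProj ℂ P = (diagProj ℂ fun k => P (K k)).submatrix K.symm K.symm := by
      rw [diagProj_submatrix]
      simp only [diagProj, Equiv.apply_symm_apply]
    have htrace (M : Matrix (Fin 6 ⊕ Fin (n - 6)) (Fin 6 ⊕ Fin (n - 6)) ℂ) :
        (M.submatrix E.symm E.symm).trace = M.trace :=
      E.symm.sum_comp fun i => M i i
    rw [hsub A E, hsub B E, hsub C F]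
    simp only [cyclicWord, conjTranspose_submatrix, submatrix_mul_equiv, htrace]
    rw [diagProj_sum fun k => A (E k), diagProj_sum fun k => B (E k), diagProj_sum fun k => C (F k)]
    simp only [U, fromBlocks_conjTranspose, fromBlocks_multiply, Matrix.mul_zero, Matrix.zero_mul,
      add_zero, zero_add, conjTranspose_zero, conjTranspose_one, Matrix.one_mul, Matrix.mul_one,
      trace_fromBlocks_eq_add, Complex.add_im]
    have hreal := im_trace_of_mem_realMatrices (cyclicWord_mem (realMatrices (Fin (n - 6)))
      (diagProj_mem_realMatrices fun k => A (E (.inr k)))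
      (diagProj_mem_realMatrices fun k => B (E (.inr k)))
      (diagProj_mem_realMatrices fun k => C (F (.inr k))))
    simp only [cyclicWord] at hreal
    have hA' : (diagProj ℂ fun i => A (E (.inl i))) = diagProj ℂ fun i : Fin 6 => i.1 / 2 = 0 :=
      diagProj_congr fun i => by rw [hE, hA]
    have hB' : (diagProj ℂ fun i => B (E (.inl i))) = diagProj ℂ fun i : Fin 6 => i.1 / 2 = 1 :=
      diagProj_congr fun i => by rw [hE, hB]
    have hC' : (diagProj ℂ fun i => C (F (.inl i))) = diagProj ℂ fun i : Fin 6 => i.1 / 3 = 0 :=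
      diagProj_congr fun i => by rw [hF, hC]
    rw [hreal, add_zero, hA', hB', hC']
    exact im_trace_cyclicWord_unitaryV

theorem blkIdx_two (p q i : ℕ) :
    blkIdx (fun t => if t = 0 then p else q) 2 i = 0 ↔ i < p := by
  simp only [blkIdx, Finset.card_eq_zero, Finset.filter_eq_empty_iff, Finset.mem_range]
  constructor
  · intro h
    simpa using h (x := 0) (by norm_num)
  · intro h j hj
    interval_cases j <;> simp [Finset.sum_range_succ] <;> omega

theorem blkIdx_three (a b c i : ℕ) :
    blkIdx (fun t => if t = 0 then a else if t = 1 then b else c) 3 i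
      = (if a ≤ i then 1 else 0) + (if a + b ≤ i then 1 else 0)
        + (if a + b + c ≤ i then 1 else 0) := by
  rw [blkIdx, Finset.card_filter]
  simp only [Finset.sum_range_succ, Finset.sum_range_zero, zero_add, one_ne_zero, if_true, if_false,
    OfNat.ofNat_ne_zero, OfNat.ofNat_ne_one]

/-- Proposition 5.6: for `n = n₁+n₂+n₃ = p+q` with `min(p,q) ≥ 3` and
`min(n₁,n₂,n₃) ≥ 2`, `L = U(n₁)×U(n₂)×U(n₃)`, `G' = O(n)`, `H = U(p)×U(q)`
(all block-diagonal in `U(n)`), one has `L·G'·H ⊊ U(n)`. -/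
theorem three_blocks_large_not_surjective
    (n n₁ n₂ n₃ p q : ℕ)
    (hn₁ : 2 ≤ n₁) (hn₂ : 2 ≤ n₂) (hn₃ : 2 ≤ n₃) (hp : 3 ≤ p) (hq : 3 ≤ q)
    (hL : n = n₁ + n₂ + n₃) (hH : n = p + q) :
    blockUnitary n 3 (fun t => if t = 0 then n₁ else if t = 1 then n₂ else n₃)
      * realOrthogonal n
      * blockUnitary n 2 (fun t => if t = 0 then p else q)
      ≠ (Matrix.unitaryGroup (Fin n) ℂ : Set (Matrix (Fin n) (Fin n) ℂ)) := by
  intro heq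
  let e : Fin 6 → Fin n := fun i =>
    ⟨(if i.1 / 2 = 0 then 0 else if i.1 / 2 = 1 then n₁ else n₁ + n₂) + i.1 % 2, by
      split_ifs <;> omega⟩
  let f : Fin 6 → Fin n := fun i => ⟨(if i.1 / 3 = 0 then 0 else p) + i.1 % 3, by
    split_ifs <;> omega⟩
  have he : Function.Injective e := by
    intro i j hij
    simp only [e, Fin.mk.injEq] at hij
    ext
    split_ifs at hij <;> omega
  have hf : Function.Injective f := by
    intro i j hij
    simp only [f, Fin.mk.injEq] at hij
    ext
    split_ifs at hij <;> omega
  obtain ⟨g, hg, hne⟩ := exists_unitary_im_trace_ne_zero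
    (fun i : Fin n =>
      blkIdx (fun t => if t = 0 then n₁ else if t = 1 then n₂ else n₃) 3 i = 0)
    (fun i : Fin n =>
      blkIdx (fun t => if t = 0 then n₁ else if t = 1 then n₂ else n₃) 3 i = 1)
    (fun i : Fin n => blkIdx (fun t => if t = 0 then p else q) 2 i = 0) he hf
    (fun i => by
      simp only [blkIdx_three, e]
      split_ifs <;> simp <;> omega)
    (fun i => by
      simp only [blkIdx_three, e]
      split_ifs <;> simp <;> omega)
    (fun i => by
      simp only [blkIdx_two, f]
      split_ifs <;> omega)
  have hmem : g ∈ (Matrix.unitaryGroup (Fin n) ℂ : Set (Matrix (Fin n) (Fin n) ℂ)) := hg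
  rw [← heq] at hmem
  exact hne (im_trace_cyclicWord_of_mem hmem 0 1 0)
end

section
/- Let n = n₁+⋯+n_k = p+q with k ≥ 4 and min(p,q) ≥ 3. Set G = U(n), L = U(n₁)×⋯×U(n_k) (block-diagonal), G' = O(n), H = U(p)×U(q) (possibly conjugated by O(n)). Then L·G'·H ≠ G. -/
open Matrix
open scoped Pointwise

theorem blkIdx_eq {ns : ℕ → ℕ} {k t i : ℕ} (ht : t < k)
    (h₁ : ∑ s ∈ Finset.range t, ns s ≤ i) (h₂ : i < ∑ s ∈ Finset.range (t + 1), ns s) :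
    blkIdx ns k i = t := by
  have hmono : Monotone fun t => ∑ s ∈ Finset.range t, ns s := fun a b hab =>
    Finset.sum_le_sum_of_subset (Finset.range_mono hab)
  have : (Finset.range k).filter (fun j => (∑ t ∈ Finset.range (j + 1), ns t) ≤ i)
      = Finset.range t := by
    ext j
    simp only [Finset.mem_filter, Finset.mem_range]
    constructor
    · rintro ⟨-, hj⟩
      by_contra hjt
      have := hmono (show t + 1 ≤ j + 1 by omega)
      simp only at this
      omega
    · intro hj
      have := hmono (show j + 1 ≤ t by omega)
      simp only at this
      omega
  rw [blkIdx, this, Finset.card_range]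

/-- The scalar block-diagonal matrix with value `c t` on the `t`-th block. -/
def blockScalar (n k : ℕ) (ns : ℕ → ℕ) (c : ℕ → ℂ) : Matrix (Fin n) (Fin n) ℂ :=
  diagonal fun i => c (blkIdx ns k i)

theorem blockScalar_mul_comm {n k : ℕ} {ns : ℕ → ℕ} (c : ℕ → ℂ)
    {u : Matrix (Fin n) (Fin n) ℂ} (hu : u ∈ blockUnitary n k ns) :
    blockScalar n k ns c * u = u * blockScalar n k ns c := by
  ext i j
  rw [blockScalar, diagonal_mul, mul_diagonal]
  by_cases h : blkIdx ns k i = blkIdx ns k j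
  · rw [h, mul_comm]
  · rw [hu.2 i j h, zero_mul, mul_zero]

/-- The trace of the cyclic product of the blocks `(0,1)`, `(1,2)`, `(2,0)` of `Q`. -/
def blockCycle (n k : ℕ) (ns : ℕ → ℕ) (Q : Matrix (Fin n) (Fin n) ℂ) : ℂ :=
  trace (blockScalar n k ns (Pi.single 0 1) * Q * blockScalar n k ns (Pi.single 1 1) * Q *
    blockScalar n k ns (Pi.single 2 1) * Q)

theorem blockCycle_conj {n k : ℕ} {ns : ℕ → ℕ} {l : Matrix (Fin n) (Fin n) ℂ}
    (hl : l ∈ blockUnitary n k ns) (R : Matrix (Fin n) (Fin n) ℂ) :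
    blockCycle n k ns (l * R * star l) = blockCycle n k ns R := by
  have hll : star l * l = 1 := (Matrix.mem_unitaryGroup_iff').1 hl.1
  unfold blockCycle
  have hc := fun c => blockScalar_mul_comm c hl
  set A := blockScalar n k ns (Pi.single 0 1)
  set B := blockScalar n k ns (Pi.single 1 1)
  set C := blockScalar n k ns (Pi.single 2 1)
  have key : A * (l * R * star l) * B * (l * R * star l) * C * (l * R * star l)
      = l * (A * R * B * R * C * R) * star l := by
    have step : ∀ (D Y : Matrix (Fin n) (Fin n) ℂ), D * l = l * D →
        star l * (D * (l * Y)) = D * Y := by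
      intro D Y h
      rw [← mul_assoc D, h, mul_assoc l, ← mul_assoc (star l), hll, one_mul]
    simp only [mul_assoc]
    rw [step C _ (hc _), step B _ (hc _), ← mul_assoc A l, hc, mul_assoc]
  rw [key, trace_mul_comm, ← mul_assoc, hll, one_mul]

theorem blockCycle_eq {n k : ℕ} {ns : ℕ → ℕ} (Q : Matrix (Fin n) (Fin n) ℂ) :
    blockCycle n k ns Q = ∑ i : Fin n, ∑ j : Fin n, ∑ m : Fin n,
      (Pi.single 0 1 : ℕ → ℂ) (blkIdx ns k i) * Q i j *
      ((Pi.single 1 1 : ℕ → ℂ) (blkIdx ns k j) * Q j m) *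
      ((Pi.single 2 1 : ℕ → ℂ) (blkIdx ns k m) * Q m i) := by
  have hd : ∀ (t : ℕ) (i j : Fin n), (blockScalar n k ns (Pi.single t 1) * Q) i j =
      (Pi.single t 1 : ℕ → ℂ) (blkIdx ns k i) * Q i j := fun t i j => by
    rw [blockScalar, diagonal_mul]
  have hmul : ∀ X Y Z : Matrix (Fin n) (Fin n) ℂ,
      trace (X * (Y * Z)) = ∑ i, ∑ j, ∑ m, X i j * (Y j m * Z m i) := fun X Y Z => by
    simp only [trace, diag_apply, mul_apply, Finset.mul_sum]
  rw [blockCycle, mul_assoc, mul_assoc _ _ Q, mul_assoc, hmul]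
  simp only [hd, mul_assoc]

theorem blockCycle_eq_of_offDiag {n k : ℕ} {ns : ℕ → ℕ} {Q : Matrix (Fin n) (Fin n) ℂ}
    {a : Fin 4 → Fin n} (ha : ∀ s, blkIdx ns k (a s) = s)
    (hQ : ∀ i j : Fin n, i ≠ j → Q i j ≠ 0 → ∃ s, i = a s) :
    blockCycle n k ns Q = Q (a 0) (a 1) * Q (a 1) (a 2) * Q (a 2) (a 0) := by
  have key : ∀ i j : Fin n, ∀ s : Fin 4, blkIdx ns k i = s → blkIdx ns k j ≠ s → i ≠ a s →
      Q i j = 0 := by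
    intro i j s hi hj his
    by_contra h
    obtain ⟨t, rfl⟩ := hQ i j (by rintro rfl; exact hj hi) h
    rw [ha] at hi
    exact his (congrArg a (Fin.ext hi))
  rw [blockCycle_eq, Fintype.sum_eq_single (a 0), Fintype.sum_eq_single (a 1),
    Fintype.sum_eq_single (a 2)]
  · simp [ha]
  · intro m hm
    by_cases h : blkIdx ns k m = 2
    · rw [key m (a 0) 2 (by simpa using h) (by simp [ha]) hm]; simp
    · simp [Pi.single_apply, h]
  · intro j hj
    refine Finset.sum_eq_zero fun m _ => ?_
    by_cases h : blkIdx ns k j = 1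
    · by_cases h' : blkIdx ns k m = 2
      · rw [key j m 1 (by simpa using h) (by simp [h']) hj]; simp
      · simp [Pi.single_apply, h']
    · simp [Pi.single_apply, h]
  · intro i hi
    refine Finset.sum_eq_zero fun j _ => Finset.sum_eq_zero fun m _ => ?_
    by_cases h : blkIdx ns k i = 0
    · by_cases h' : blkIdx ns k j = 1
      · rw [key i j 0 (by simpa using h) (by simp [h']) hi]; simp
      · simp [Pi.single_apply, h']
    · simp [Pi.single_apply, h]

theorem im_mul_eq_zero {n : ℕ} {A B : Matrix (Fin n) (Fin n) ℂ}
    (hA : ∀ i j, (A i j).im = 0) (hB : ∀ i j, (B i j).im = 0) (i j : Fin n) :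
    ((A * B) i j).im = 0 := by
  simp [mul_apply, Complex.mul_im, hA, hB]

theorem im_blockScalar_eq_zero {n k : ℕ} {ns : ℕ → ℕ} (t : ℕ) (i j : Fin n) :
    (blockScalar n k ns (Pi.single t 1) i j).im = 0 := by
  simp only [blockScalar, diagonal_apply, Pi.single_apply]
  split_ifs <;> simp

theorem im_blockCycle_eq_zero {n k : ℕ} {ns : ℕ → ℕ} {R : Matrix (Fin n) (Fin n) ℂ}
    (hR : ∀ i j, (R i j).im = 0) : (blockCycle n k ns R).im = 0 := by
  rw [blockCycle, trace, Complex.im_sum]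
  refine Finset.sum_eq_zero fun i _ => ?_
  have h := fun t => im_blockScalar_eq_zero (n := n) (k := k) (ns := ns) t
  exact im_mul_eq_zero (im_mul_eq_zero (im_mul_eq_zero (im_mul_eq_zero (im_mul_eq_zero
    (h 0) hR) (h 1)) hR) (h 2)) hR i i

/-- A unitary matrix whose first two columns span a plane in `ℂ⁴` that is not equivalent to a
real plane under diagonal unitary matrices. -/
noncomputable def twistedUnitary : Matrix (Fin 4) (Fin 4) ℂ :=
  (1 / 2 : ℂ) • !![1, 0, 1, 1 + Complex.I; 1, 1, Complex.I, -Complex.I;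
    1, Complex.I, -Complex.I, -1; 1, -1 - Complex.I, -1, 0]

theorem twistedUnitary_mul_star : twistedUnitary * star twistedUnitary = 1 := by
  ext i j
  fin_cases i <;> fin_cases j <;>
    simp [twistedUnitary, mul_apply, Fin.sum_univ_four, star_apply, Complex.ext_iff] <;>
    norm_num

theorem exists_equiv_sum {n : ℕ} (a : Fin 4 → Fin n) (ha : Function.Injective a) :
    ∃ e : Fin n ≃ Fin 4 ⊕ Fin (n - 4), ∀ s, e (a s) = Sum.inl s := by
  classical
  have hcard : Fintype.card ((Set.range a)ᶜ : Set (Fin n)) = n - 4 := by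
    rw [Fintype.card_compl_set, Set.card_range_of_injective ha]; simp
  refine ⟨(Equiv.Set.sumCompl (Set.range a)).symm.trans
    (Equiv.sumCongr (Equiv.ofInjective a ha).symm (Fintype.equivFinOfCardEq hcard)), fun s => ?_⟩
  rw [Equiv.trans_apply, Equiv.Set.sumCompl_symm_apply_of_mem (Set.mem_range_self s)]
  simp only [Equiv.sumCongr_apply, Sum.map_inl]
  rw [Equiv.ofInjective_symm_apply]

/-- Some `p`-dimensional subspace of `ℂⁿ` has a projection with nonreal block cycle. -/
theorem exists_unitary_im_blockCycle_ne_zero {n k p q : ℕ} {ns : ℕ → ℕ} (hk : 4 ≤ k)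
    (hns : ∀ i < k, 0 < ns i) (hn : n = ∑ t ∈ Finset.range k, ns t)
    (hpq : n = p + q) (hp : 2 ≤ p) (hq : 2 ≤ q) :
    ∃ g ∈ Matrix.unitaryGroup (Fin n) ℂ, (blockCycle n k ns
      (g * blockScalar n 2 (fun t => if t = 0 then p else q) (Pi.single 0 1) * star g)).im ≠ 0 := by
  have hlt : ∀ s : Fin 4, ∑ t ∈ Finset.range s, ns t < ∑ t ∈ Finset.range (s + 1), ns t := by
    intro s
    rw [Finset.sum_range_succ]
    have := hns s (by omega)
    omega
  have hle : ∀ s : Fin 4, ∑ t ∈ Finset.range (s + 1), ns t ≤ n := by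
    intro s
    rw [hn]
    exact Finset.sum_le_sum_of_subset (Finset.range_mono (by omega))
  let a : Fin 4 → Fin n := fun s => ⟨∑ t ∈ Finset.range s, ns t, (hlt s).trans_le (hle s)⟩
  have ha : ∀ s, blkIdx ns k (a s) = s := fun s => blkIdx_eq (by omega) le_rfl (hlt s)
  let b : Fin 4 → Fin n := ![⟨0, by omega⟩, ⟨1, by omega⟩, ⟨p, by omega⟩, ⟨p + 1, by omega⟩]
  have hb : Function.Injective b := by
    intro s t h
    fin_cases s <;> fin_cases t <;> simp [b] at h ⊢ <;> omega
  obtain ⟨e, he⟩ := exists_equiv_sum a fun s t h => by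
    have := ha s
    rw [h, ha] at this
    exact (Fin.ext this).symm
  obtain ⟨f, hf⟩ := exists_equiv_sum b hb
  set ns' : ℕ → ℕ := fun t => if t = 0 then p else q with hns'
  have hb0 : ∀ s, (Pi.single 0 1 : ℕ → ℂ) (blkIdx ns' 2 (b s)) = if s < 2 then 1 else 0 := by
    have h0 : ∀ i < p, blkIdx ns' 2 i = 0 := fun i hi => blkIdx_eq (by omega) (by simp)
      (by simpa [hns'] using hi)
    have h1 : ∀ i, p ≤ i → i < n → blkIdx ns' 2 i = 1 := fun i hi hin =>
      blkIdx_eq (by omega) (by simpa [hns'] using hi)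
        (by simpa [hns', Finset.sum_range_succ, ← hpq] using hin)
    intro s
    fin_cases s
    · simp [b, h0 0 (by omega)]
    · simp [b, h0 1 (by omega)]
    · simp [b, h1 p (by omega) (by omega)]
    · simp [b, h1 (p + 1) (by omega) (by omega)]
  let M : Matrix (Fin 4 ⊕ Fin (n - 4)) (Fin 4 ⊕ Fin (n - 4)) ℂ := fromBlocks twistedUnitary 0 0 1
  have hM : M * star M = 1 := by
    have h := twistedUnitary_mul_star
    rw [star_eq_conjTranspose] at h ⊢
    simp [M, fromBlocks_conjTranspose, fromBlocks_multiply, h]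
  refine ⟨M.submatrix e f, ?_, ?_⟩
  · rw [mem_unitaryGroup_iff, star_eq_conjTranspose, conjTranspose_submatrix,
      submatrix_mul_equiv, ← star_eq_conjTranspose, hM, submatrix_one_equiv]
  set Q := M.submatrix e f * blockScalar n 2 ns' (Pi.single 0 1) * star (M.submatrix e f) with hQ
  have hQ' : ∀ i j, Q i j = ∑ x, M (e i) x *
      (Pi.single 0 1 : ℕ → ℂ) (blkIdx ns' 2 (f.symm x)) * star (M (e j) x) := by
    intro i j
    rw [hQ, mul_apply, ← f.sum_comp]
    simp [blockScalar, mul_diagonal, star_apply]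
  have hQa : ∀ s t, Q (a s) (a t) =
      twistedUnitary s 0 * star (twistedUnitary t 0) +
      twistedUnitary s 1 * star (twistedUnitary t 1) := by
    intro s t
    have hf' : ∀ s, f.symm (Sum.inl s) = b s := fun s => by rw [Equiv.symm_apply_eq, hf]
    rw [hQ', he, he, Fintype.sum_sum_type]
    simp [M, hf', hb0, Fin.sum_univ_four]
  rw [blockCycle_eq_of_offDiag ha]
  · simp [hQa, twistedUnitary]
  · intro i j hij h
    rcases hi : e i with s | x
    · exact ⟨s, e.injective (by rw [hi, he])⟩
    · refine absurd ?_ h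
      rw [hQ', hi]
      rcases hj : e j with t | y
      · simp [M]
      · have hxy : y ≠ x := by
          rintro rfl
          exact hij (e.injective (hi.trans hj.symm))
        simp [M, one_apply, hxy.symm]

/-- Proposition 5.8: `n = n₁+⋯+n_k = p+q`, `k ≥ 4`, `min(p,q) ≥ 3`,
all `nᵢ ≥ 1`; `L = U(n₁)×⋯×U(n_k)` block-diagonal, `G' = O(n)`, and `H` an
`O(n)`-conjugate of the block-diagonal `U(p)×U(q)`.  Then `L·G'·H ⊊ U(n)`. -/
theorem k_blocks_minpq_ge_three_not_surjective
    (n k p q : ℕ) (hk : 4 ≤ k) (ns : ℕ → ℕ) (hns : ∀ i < k, 0 < ns i)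
    (hn : n = ∑ t ∈ Finset.range k, ns t)
    (hpq : n = p + q) (hp : 3 ≤ p) (hq : 3 ≤ q)
    (H : Set (Matrix (Fin n) (Fin n) ℂ))
    (w : Matrix (Fin n) (Fin n) ℂ) (hw : w ∈ realOrthogonal n)
    (hH : H = (fun x => w * x * w⁻¹) ''
      blockUnitary n 2 (fun t => if t = 0 then p else q)) :
    blockUnitary n k ns * realOrthogonal n * H
      ≠ (Matrix.unitaryGroup (Fin n) ℂ : Set (Matrix (Fin n) (Fin n) ℂ)) := by
  obtain ⟨g, hg, him⟩ := exists_unitary_im_blockCycle_ne_zero hk hns hn hpq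
    (show 2 ≤ p by omega) (show 2 ≤ q by omega)
  intro h
  have hw' : star w * w = 1 := mem_unitaryGroup_iff'.1 hw.1
  have hinv : w⁻¹ = star w := inv_eq_left_inv hw'
  have hgw : g * star w ∈ (Matrix.unitaryGroup (Fin n) ℂ : Set (Matrix (Fin n) (Fin n) ℂ)) :=
    mul_mem hg (Unitary.star_mem hw.1)
  rw [← h, hH] at hgw
  obtain ⟨_, ⟨l, hl, o, ho, rfl⟩, _, ⟨u, hu, rfl⟩, heq⟩ := hgw
  have hg' : g = l * (o * w) * u := by
    have := congrArg (· * w) heq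
    simp only [hinv, mul_assoc, hw', mul_one] at this
    simpa only [mul_assoc] using this.symm
  apply him
  set P := blockScalar n 2 (fun t => if t = 0 then p else q) (Pi.single 0 1)
  have hR : g * P * star g = l * (o * w * P * star (o * w)) * star l := by
    have hPu : u * P * star u = P := by
      rw [← blockScalar_mul_comm _ hu, mul_assoc, mem_unitaryGroup_iff.1 hu.1, mul_one]
    calc g * P * star g = l * (o * w * (u * P * star u) * star (o * w)) * star l := by
          rw [hg']; simp only [star_mul, mul_assoc]
      _ = _ := by rw [hPu]
  rw [hR, blockCycle_conj hl]
  have hx := im_mul_eq_zero ho.2 hw.2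
  exact im_blockCycle_eq_zero (im_mul_eq_zero (im_mul_eq_zero hx
    (im_blockScalar_eq_zero 0)) fun i j => by simp [star_apply, hx])
end
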